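/- For every integer d ≥ 1 and every α ≥ 0 there exist constants c, C > 0 such that for every continuous function f : ℝ^d → ℝ and every x ∈ ℝ^d, one has c·f*_α(x) ≤ f♯_α(x) ≤ C·f*_α(x), as an inequality of values in [0,∞]. -/

import Mathlib

open MeasureTheory Real Set
open scoped ENNReal

noncomputable section

/-- The pointwise maximal heat quantity
`f*_α(x) = sup_{τ>0} (1+τ)^α ∫ (2πτ)^{-d/2} e^{-|x-y|²/(2τ)} |f(y)| dy ∈ [0,∞]`. -/
def fstar {d : ℕ} (α : ℝ) (f : EuclideanSpace ℝ (Fin d) → ℝ)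
    (x : EuclideanSpace ℝ (Fin d)) : ℝ≥0∞ :=
  ⨆ τ ∈ Set.Ioi (0:ℝ), ENNReal.ofReal ((1 + τ) ^ α) *
    ∫⁻ y, ENNReal.ofReal ((2 * π * τ) ^ (-(d:ℝ)/2) * Real.exp (-‖x - y‖^2 / (2 * τ)) * |f y|)

/-- The pointwise maximal-function quantity
`f♯_α(x) = sup_{ρ>0} (1+ρ²)^α ⨍_{B(x,ρ)} |f| ∈ [0,∞]`. -/
def fsharp {d : ℕ} (α : ℝ) (f : EuclideanSpace ℝ (Fin d) → ℝ)
    (x : EuclideanSpace ℝ (Fin d)) : ℝ≥0∞ :=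
  ⨆ ρ ∈ Set.Ioi (0:ℝ), ENNReal.ofReal ((1 + ρ ^ 2) ^ α) *
    ((∫⁻ y in Metric.ball x ρ, ENNReal.ofReal |f y|) / volume (Metric.ball x ρ))

/-- The space `H⁰_α`: locally integrable functions with `f*_α(x) < ∞` for every `x`. -/
def MemH0 {d : ℕ} (α : ℝ) (f : EuclideanSpace ℝ (Fin d) → ℝ) : Prop :=
  LocallyIntegrable f (volume : Measure (EuclideanSpace ℝ (Fin d))) ∧ ∀ x, fstar α f x < ⊤

lemma aux_const {d : ℕ} (r : ℝ) (hr : 0 < r) :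
    (2 * π * r ^ 2) ^ (-(d:ℝ)/2) = (2 * π) ^ (-(d:ℝ)/2) * (r ^ d)⁻¹ := by
  rw [Real.mul_rpow (by positivity) (by positivity)]
  congr 1
  rw [← Real.rpow_natCast r 2, ← Real.rpow_mul hr.le, ← Real.rpow_natCast r d,
    ← Real.rpow_neg hr.le]
  congr 1
  push_cast
  ring

lemma aux_vol {d : ℕ} (x : EuclideanSpace ℝ (Fin d)) (r : ℝ) (hr : 0 < r) :
    volume (Metric.ball x r) = ENNReal.ofReal
      (r ^ d * (volume (Metric.ball (0 : EuclideanSpace ℝ (Fin d)) 1)).toReal) := by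
  rw [Measure.addHaar_ball_of_pos _ _ hr, ENNReal.ofReal_mul (by positivity),
    ENNReal.ofReal_toReal measure_ball_lt_top.ne]
  simp

lemma aux_summable (d : ℕ) : Summable fun n : ℕ => Real.exp (-(n:ℝ)/2) * ((n:ℝ)+1) ^ d := by
  have h := (summable_nat_add_iff 1).2
    (Real.summable_pow_mul_exp_neg_nat_mul d (r := 1/2) (by norm_num))
  refine (h.mul_left (Real.exp (1/2))).congr fun n => ?_
  have : Real.exp (-(n:ℝ)/2) = Real.exp (1/2) * Real.exp (-(1/2) * ((n+1 : ℕ):ℝ)) := by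
    rw [← Real.exp_add]; congr 1; push_cast; ring
  rw [this]; push_cast; ring

lemma aux_lower {d : ℕ} (α : ℝ) (hα : 0 ≤ α) (f : EuclideanSpace ℝ (Fin d) → ℝ)
    (hf : Continuous f) (x : EuclideanSpace ℝ (Fin d)) (V K : ℝ)
    (hV : V = (volume (Metric.ball (0 : EuclideanSpace ℝ (Fin d)) 1)).toReal) (hV0 : 0 < V)
    (hK : K = (2 * π) ^ (-(d:ℝ)/2)) (hK0 : 0 < K) :
    fstar α f x ≤ ENNReal.ofReal
      (∑' n : ℕ, K * V * (Real.exp (-(n:ℝ)/2) * ((n:ℝ)+1) ^ d)) * fsharp α f x := by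
  have key : ∀ ρ : ℝ, 0 < ρ → ENNReal.ofReal ((1 + ρ ^ 2) ^ α) *
      (∫⁻ y in Metric.ball x ρ, ENNReal.ofReal |f y|) ≤
        fsharp α f x * ENNReal.ofReal (ρ ^ d * V) := by
    intro ρ hρ
    have h : ENNReal.ofReal ((1 + ρ ^ 2) ^ α) *
        ((∫⁻ y in Metric.ball x ρ, ENNReal.ofReal |f y|) / volume (Metric.ball x ρ)) ≤
        fsharp α f x := by
      unfold fsharp
      exact le_iSup₂ (f := fun (ρ : ℝ) (_ : ρ ∈ Set.Ioi (0:ℝ)) =>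
        ENNReal.ofReal ((1 + ρ ^ 2) ^ α) *
        ((∫⁻ y in Metric.ball x ρ, ENNReal.ofReal |f y|) / volume (Metric.ball x ρ))) ρ hρ
    rw [← mul_div_assoc, aux_vol x ρ hρ, ← hV] at h
    have hp : 0 < ρ ^ d * V := by positivity
    exact (ENNReal.div_le_iff (by simpa using hp) ENNReal.ofReal_ne_top).1 h
  have hcm : Measurable fun y => ENNReal.ofReal |f y| := by fun_prop
  unfold fstar
  refine iSup₂_le fun τ hτ => ?_
  have hτ : 0 < τ := hτ
  obtain ⟨r, hr, rfl⟩ : ∃ r : ℝ, 0 < r ∧ r ^ 2 = τ :=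
    ⟨√τ, Real.sqrt_pos.2 hτ, Real.sq_sqrt hτ.le⟩
  rw [aux_const r hr, ← hK]
  have hpt : ∀ y, ENNReal.ofReal (K * (r ^ d)⁻¹ * Real.exp (-‖x - y‖^2 / (2 * r ^ 2)) * |f y|) ≤
      ∑' n : ℕ, ENNReal.ofReal (K * (r ^ d)⁻¹ * Real.exp (-(n:ℝ)/2)) *
        (Metric.ball x (((n:ℝ)+1) * r)).indicator (fun y => ENNReal.ofReal |f y|) y := by
    intro y
    set n := ⌊‖x - y‖ / r⌋₊ with hn
    refine le_trans ?_ (ENNReal.le_tsum n)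
    have h1 : (n:ℝ) * r ≤ ‖x - y‖ := by
      rw [← le_div_iff₀ hr]; exact Nat.floor_le (by positivity)
    have h2 : ‖x - y‖ < ((n:ℝ)+1) * r := by
      rw [← div_lt_iff₀ hr]; exact Nat.lt_floor_add_one _
    have hy : y ∈ Metric.ball x (((n:ℝ)+1) * r) := by
      rw [Metric.mem_ball, dist_comm, dist_eq_norm]; exact h2
    rw [Set.indicator_of_mem hy, ← ENNReal.ofReal_mul (by positivity)]
    apply ENNReal.ofReal_le_ofReal
    gcongr K * (r ^ d)⁻¹ * Real.exp ?_ * |f y|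
    rw [div_le_div_iff₀ (by positivity) (by positivity)]
    have h3 : (n:ℝ) ≤ (n:ℝ)^2 := by
      exact_mod_cast Nat.le_self_pow (by norm_num) n
    have h4 : ((n:ℝ) * r)^2 ≤ ‖x - y‖^2 := by gcongr
    have h5 : (n:ℝ) * r^2 ≤ (n:ℝ)^2 * r^2 := by gcongr
    nlinarith
  calc _ ≤ ENNReal.ofReal ((1 + r ^ 2) ^ α) * ∫⁻ y,
        ∑' n : ℕ, ENNReal.ofReal (K * (r ^ d)⁻¹ * Real.exp (-(n:ℝ)/2)) *
        (Metric.ball x (((n:ℝ)+1) * r)).indicator (fun y => ENNReal.ofReal |f y|) y := by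
        gcongr with y; exact hpt y
    _ = ∑' n : ℕ, ENNReal.ofReal (K * (r ^ d)⁻¹ * Real.exp (-(n:ℝ)/2)) *
        (ENNReal.ofReal ((1 + r ^ 2) ^ α) *
          ∫⁻ y in Metric.ball x (((n:ℝ)+1) * r), ENNReal.ofReal |f y|) := by
        rw [lintegral_tsum, ← ENNReal.tsum_mul_left]
        · congr 1; ext n
          rw [lintegral_const_mul _ (hcm.indicator Metric.isOpen_ball.measurableSet),
            lintegral_indicator Metric.isOpen_ball.measurableSet]
          ring
        · intro n
          exact ((hcm.indicator Metric.isOpen_ball.measurableSet).const_mul _).aemeasurable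
    _ ≤ ∑' n : ℕ, ENNReal.ofReal (K * V * (Real.exp (-(n:ℝ)/2) * ((n:ℝ)+1) ^ d)) *
          fsharp α f x := by
        refine ENNReal.tsum_le_tsum fun n => ?_
        have hle : ENNReal.ofReal ((1 + r ^ 2) ^ α) ≤
            ENNReal.ofReal ((1 + (((n:ℝ)+1) * r) ^ 2) ^ α) := by
          apply ENNReal.ofReal_le_ofReal
          have : r ≤ ((n:ℝ)+1) * r := by
            have : 0 ≤ (n:ℝ) * r := by positivity
            linarith
          gcongr
        calc _ ≤ ENNReal.ofReal (K * (r ^ d)⁻¹ * Real.exp (-(n:ℝ)/2)) *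
              (fsharp α f x * ENNReal.ofReal ((((n:ℝ)+1) * r) ^ d * V)) := by
              refine mul_le_mul_right ?_ _
              exact le_trans (mul_le_mul_left hle _) (key (((n:ℝ)+1) * r) (by positivity))
          _ = _ := by
              rw [mul_comm (fsharp α f x), ← mul_assoc, ← ENNReal.ofReal_mul (by positivity)]
              congr 2
              rw [mul_pow]
              have : r ^ d ≠ 0 := by positivity
              field_simp
    _ = _ := by
        rw [ENNReal.tsum_mul_right, ENNReal.ofReal_tsum_of_nonneg]
        · intro n; positivity
        · exact (aux_summable d).mul_left _

lemma aux_upper {d : ℕ} (α : ℝ) (f : EuclideanSpace ℝ (Fin d) → ℝ)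
    (x : EuclideanSpace ℝ (Fin d)) (V K : ℝ)
    (hV : V = (volume (Metric.ball (0 : EuclideanSpace ℝ (Fin d)) 1)).toReal) (hV0 : 0 < V)
    (hK : K = (2 * π) ^ (-(d:ℝ)/2)) (hK0 : 0 < K) :
    fsharp α f x ≤ ENNReal.ofReal (K⁻¹ * Real.exp (1/2) * V⁻¹) * fstar α f x := by
  unfold fsharp
  refine iSup₂_le fun r hr => ?_
  have hr : 0 < r := hr
  have h : ENNReal.ofReal ((1 + r ^ 2) ^ α) *
      ∫⁻ y, ENNReal.ofReal ((2 * π * r ^ 2) ^ (-(d:ℝ)/2) *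
        Real.exp (-‖x - y‖^2 / (2 * r ^ 2)) * |f y|) ≤ fstar α f x := by
    unfold fstar
    exact le_iSup₂ (f := fun (τ : ℝ) (_ : τ ∈ Set.Ioi (0:ℝ)) => ENNReal.ofReal ((1 + τ) ^ α) *
      ∫⁻ y, ENNReal.ofReal ((2 * π * τ) ^ (-(d:ℝ)/2) *
        Real.exp (-‖x - y‖^2 / (2 * τ)) * |f y|)) (r ^ 2) (by simpa using pow_pos hr 2)
  rw [aux_const r hr, ← hK] at h
  refine le_trans ?_ (mul_le_mul_right h _)
  rw [mul_left_comm]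
  refine mul_le_mul_right ?_ _
  have hp : 0 < r ^ d * V := by positivity
  rw [aux_vol x r hr, ← hV, div_eq_mul_inv, ← ENNReal.ofReal_inv_of_pos hp, mul_comm,
    ← lintegral_const_mul' _ _ ENNReal.ofReal_ne_top,
    ← lintegral_const_mul' _ _ ENNReal.ofReal_ne_top]
  refine le_trans (setLIntegral_mono' Metric.isOpen_ball.measurableSet fun y hy => ?_)
    (setLIntegral_le_lintegral _ _)
  rw [← ENNReal.ofReal_mul (by positivity), ← ENNReal.ofReal_mul (by positivity)]
  apply ENNReal.ofReal_le_ofReal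
  rw [Metric.mem_ball, dist_comm, dist_eq_norm] at hy
  have h1 : 1 ≤ Real.exp (1/2) * Real.exp (-‖x - y‖^2 / (2 * r ^ 2)) := by
    rw [← Real.exp_add]
    apply Real.one_le_exp
    have : ‖x - y‖^2 ≤ r^2 := by gcongr
    rw [div_add_div _ _ (by norm_num) (by positivity)]
    apply div_nonneg _ (by positivity)
    linarith
  have h2 : K⁻¹ * Real.exp (1/2) * V⁻¹ *
      (K * (r ^ d)⁻¹ * Real.exp (-‖x - y‖^2 / (2 * r ^ 2)) * |f y|) =
      (r ^ d * V)⁻¹ * |f y| * (Real.exp (1/2) * Real.exp (-‖x - y‖^2 / (2 * r ^ 2))) := by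
    have : r ^ d ≠ 0 := by positivity
    field_simp
  rw [h2]
  exact le_mul_of_one_le_right (by positivity) h1

/-- For every `d ≥ 1` and `α ≥ 0` there are `c, C > 0` such that
`c f*_α(x) ≤ f♯_α(x) ≤ C f*_α(x)` for every continuous `f` and every `x`, as an inequality
in `[0,∞]`. -/
theorem statement8 {d : ℕ} (hd : 1 ≤ d) (α : ℝ) (hα : 0 ≤ α) :
    ∃ c > (0:ℝ), ∃ C > (0:ℝ),
      ∀ f : EuclideanSpace ℝ (Fin d) → ℝ, Continuous f → ∀ x,
        ENNReal.ofReal c * fstar α f x ≤ fsharp α f x ∧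
        fsharp α f x ≤ ENNReal.ofReal C * fstar α f x := by
  obtain ⟨V, hV⟩ : ∃ V, V = (volume (Metric.ball (0 : EuclideanSpace ℝ (Fin d)) 1)).toReal :=
    ⟨_, rfl⟩
  obtain ⟨K, hK⟩ : ∃ K : ℝ, K = (2 * π) ^ (-(d:ℝ)/2) := ⟨_, rfl⟩
  have hV0 : 0 < V := by
    rw [hV]
    exact ENNReal.toReal_pos (Metric.measure_ball_pos _ _ one_pos).ne' measure_ball_lt_top.ne
  have hK0 : 0 < K := by rw [hK]; positivity
  have hM : 0 < ∑' n : ℕ, K * V * (Real.exp (-(n:ℝ)/2) * ((n:ℝ)+1) ^ d) :=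
    ((aux_summable d).mul_left _).tsum_pos (fun n => by positivity) 0 (by positivity)
  refine ⟨_, inv_pos.2 hM, K⁻¹ * Real.exp (1/2) * V⁻¹, by positivity, fun f hf x => ⟨?_,
    aux_upper α f x V K hV hV0 hK hK0⟩⟩
  refine le_trans (mul_le_mul_right (aux_lower α hα f hf x V K hV hV0 hK hK0) _) ?_
  rw [← mul_assoc, ← ENNReal.ofReal_mul (inv_pos.2 hM).le, inv_mul_cancel₀ hM.ne']
  simp
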